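/- arXiv:1508.00999 — 2 statements merged into one kernel-verified Lean document; each statement's English description precedes it below -/
import Mathlib

section
/- Fix reals a ≥ 0 and 0 ≤ α ≤ β. There exists a constant M = M(a,α,β) > 0 such that for every integer n ≥ 1 and every x ≥ 0, the fourth central moment satisfies T_{n,a}^{α,β}((t−x)⁴;x) ≤ M·(x⁴+x³+x²+x+1)/(n+β)². -/
open MeasureTheory Filter

/-- Rising factorial `(n)_i = n(n+1)⋯(n+i−1)`, with `(n)_0 = 1`. -/
noncomputable def risingFac (n i : ℕ) : ℝ := ∏ j ∈ Finset.range i, ((n : ℝ) + j)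

/-- `p_k(n,a) = Σ_{i=0}^{k} C(k,i)·(n)_i·a^{k−i}`. -/
noncomputable def pCoef (n : ℕ) (a : ℝ) (k : ℕ) : ℝ :=
  ∑ i ∈ Finset.range (k + 1), (Nat.choose k i : ℝ) * risingFac n i * a ^ (k - i)

/-- Generalized Baskakov basis function `W_{n,k}^a(x)`. -/
noncomputable def W (n : ℕ) (a : ℝ) (k : ℕ) (x : ℝ) : ℝ :=
  Real.exp (-(a * x) / (1 + x)) * (pCoef n a k / (Nat.factorial k : ℝ)) * x ^ k /
    (1 + x) ^ (k + n)

/-- Stancu-type operator `L_{n,a}^{α,β}(f;x) = Σ_k W_{n,k}^a(x) f((k+α)/(n+β))`. -/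
noncomputable def Lop (n : ℕ) (a α β : ℝ) (f : ℝ → ℝ) (x : ℝ) : ℝ :=
  ∑' k : ℕ, W n a k x * f (((k : ℝ) + α) / ((n : ℝ) + β))

/-- Generalized Baskakov–Kantorovich–Stancu operator `T_{n,a}^{α,β}(f;x)`. -/
noncomputable def TKS (n : ℕ) (a α β : ℝ) (f : ℝ → ℝ) (x : ℝ) : ℝ :=
  ((n : ℝ) + β) *
    ∑' k : ℕ, W n a k x *
      ∫ t in (((k : ℝ) + α) / ((n : ℝ) + β))..(((k : ℝ) + α + 1) / ((n : ℝ) + β)), f t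


lemma aux_choose (m i : ℕ) : risingFac (m+1) i / (i.factorial : ℝ) = ((i+m).choose m : ℝ) := by
  induction i with
  | zero => simp [risingFac]
  | succ i ih =>
    have h1 : risingFac (m+1) (i+1) = risingFac (m+1) i * ((m:ℝ)+1+i) := by
      simp [risingFac, Finset.prod_range_succ]
    have h2 : ((i+1+m).choose m : ℝ) * (i+1) = ((i+m).choose m : ℝ) * (i+m+1) := by
      have := Nat.choose_mul_succ_eq (i+m) m
      have e : i + m + 1 - m = i + 1 := by omega
      rw [e] at this
      have e2 : i + 1 + m = i + m + 1 := by omega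
      rw [e2]
      exact_mod_cast this.symm
    have h3 : ((i:ℝ)+1) ≠ 0 := by positivity
    have h4 : (i.factorial : ℝ) ≠ 0 := by positivity
    rw [h1, Nat.factorial_succ]
    push_cast
    rw [div_eq_iff h4] at ih
    rw [ih, div_eq_iff (by positivity)]
    linear_combination (-(i.factorial:ℝ)) * h2

lemma aux_hasSum (n : ℕ) (hn : 1 ≤ n) (y : ℝ) (hy0 : 0 ≤ y) (hy : y < 1) :
    HasSum (fun i : ℕ => risingFac n i / (i.factorial : ℝ) * y ^ i) (1 / (1 - y) ^ n) := by
  obtain ⟨m, rfl⟩ : ∃ m, n = m + 1 := ⟨n - 1, by omega⟩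
  simp only [aux_choose]
  apply hasSum_choose_mul_geometric_of_norm_lt_one
  rw [Real.norm_of_nonneg hy0]; exact hy

lemma aux_shift (n r i : ℕ) :
    risingFac (n + i) r * risingFac n i = risingFac n r * risingFac (n + r) i := by
  have key : ∀ p q : ℕ, risingFac n p * risingFac (n + p) q = risingFac n (p + q) := by
    intro p q
    simp only [risingFac, Finset.prod_range_add]
    congr 1
    apply Finset.prod_congr rfl
    intro j _
    push_cast; ring
  rw [mul_comm, key, key, add_comm]

lemma aux_mom (n : ℕ) (hn : 1 ≤ n) (x : ℝ) (hx : 0 ≤ x) (r : ℕ) :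
    HasSum (fun i : ℕ => (risingFac n i / (i.factorial : ℝ) * (x/(1+x)) ^ i / (1+x)^n)
      * risingFac (n + i) r) (risingFac n r * (1+x)^r) := by
  have hs : 0 < 1 + x := by positivity
  have h := (aux_hasSum (n + r) (by omega) (x/(1+x)) (by positivity)
    (by rw [div_lt_one hs]; linarith)).mul_left (risingFac n r / (1+x)^n)
  have e : 1 - x/(1+x) = 1/(1+x) := by field_simp; ring
  have e1 : (fun i : ℕ => (risingFac n i / (i.factorial : ℝ) * (x/(1+x)) ^ i / (1+x)^n)
      * risingFac (n + i) r) = fun i : ℕ => risingFac n r / (1 + x) ^ n *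
        (risingFac (n + r) i / (i.factorial : ℝ) * (x / (1 + x)) ^ i) := by
    funext i
    have := aux_shift n r i
    linear_combination ((x/(1+x)) ^ i / (1+x)^n / (i.factorial : ℝ)) * this
  have e2 : risingFac n r * (1+x)^r =
      risingFac n r / (1 + x) ^ n * (1 / (1 - x / (1 + x)) ^ (n + r)) := by
    rw [e, div_pow, one_pow, pow_add]
    field_simp
  rw [e1, e2]
  exact h

lemma aux_four (n : ℕ) (hn : 1 ≤ n) (x : ℝ) (hx : 0 ≤ x) :
    HasSum (fun i : ℕ => (risingFac n i / (i.factorial : ℝ) * (x/(1+x)) ^ i / (1+x)^n)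
      * ((i:ℝ) - n * x)^4) (3*n^2*x^2*(1+x)^2 + n*x*(1+x)*(1+6*x+6*x^2)) := by
  have h0 := aux_mom n hn x hx 0
  have h1 := aux_mom n hn x hx 1
  have h2 := aux_mom n hn x hx 2
  have h3 := aux_mom n hn x hx 3
  have h4 := aux_mom n hn x hx 4
  set c : ℝ := n * (1+x) with hc
  have h := (((h4.add (h3.mul_left (-6 - 4*c))).add (h2.mul_left (7 + 12*c + 6*c^2))).add
    (h1.mul_left (-1 - 4*c - 6*c^2 - 4*c^3))).add (h0.mul_left (c^4))
  convert h using 1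
  · ext i
    simp [risingFac, Finset.prod_range_succ, hc]
    ring
  · simp [risingFac, Finset.prod_range_succ, hc]
    ring

lemma aux_W (n : ℕ) (a : ℝ) (k : ℕ) (x : ℝ) (hx : 0 ≤ x) :
    W n a k x = ∑ i ∈ Finset.range (k+1),
      (risingFac n i / (i.factorial : ℝ) * (x/(1+x)) ^ i / (1+x)^n) *
      (Real.exp (-(a*x)/(1+x)) * ((a*x/(1+x))^(k-i) / ((k-i).factorial : ℝ))) := by
  have hs : 0 < 1 + x := by positivity
  unfold W pCoef
  rw [Finset.sum_div, Finset.mul_sum, Finset.sum_mul, Finset.sum_div]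
  apply Finset.sum_congr rfl
  intro i hi
  have hik : i ≤ k := by simpa [Nat.lt_succ_iff] using hi
  obtain ⟨j, rfl⟩ := Nat.exists_eq_add_of_le hik
  have hch : ((i+j).choose i : ℝ) = ((i+j).factorial : ℝ) / (i.factorial * j.factorial) := by
    rw [Nat.cast_choose ℝ hik]; simp
  rw [hch]
  simp only [Nat.add_sub_cancel_left]
  generalize Real.exp _ = E
  rw [div_pow, div_pow, mul_pow, pow_add, pow_add, pow_add]
  field_simp

lemma aux_rnn (n i : ℕ) : 0 ≤ risingFac n i := Finset.prod_nonneg (fun _ _ => by positivity)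

lemma aux_sum4 (p q r s : ℝ) : (p + q + r + s)^4 ≤ 64 * (p^4 + q^4 + r^4 + s^4) := by
  have h : ∀ u v : ℝ, (u+v)^4 ≤ 8*(u^4+v^4) := by
    intro u v
    nlinarith [sq_nonneg (u-v), sq_nonneg (u+v), sq_nonneg (u^2-v^2), sq_nonneg (u*(u-v)),
      sq_nonneg (v*(u-v)), sq_nonneg ((u-v)*(u-v)), sq_nonneg ((u-v)*(u+v))]
  have h1 := h (p+q) (r+s)
  have h2 := h p q
  have h3 := h r s
  have : p + q + r + s = (p+q)+(r+s) := by ring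
  rw [this]
  linarith

lemma aux_integral (n : ℕ) (hn : 1 ≤ n) (α β x : ℝ) (hα : 0 ≤ α) (hβ : 0 ≤ β) (i j : ℕ) :
    ((n:ℝ)+β) * ∫ t in ((((i+j:ℕ):ℝ) + α) / ((n : ℝ) + β))..((((i+j:ℕ):ℝ) + α + 1) / ((n : ℝ) + β)),
      (t-x)^4 ≤ 64 * (((i:ℝ)-n*x)^4 + (24 * Real.exp j + ((α+1)^4 + (β*x)^4))) / ((n:ℝ)+β)^4 := by
  have hn' : (1:ℝ) ≤ n := by exact_mod_cast hn
  have hN : 0 < (n:ℝ) + β := by linarith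
  set N := (n:ℝ)+β with hNd
  set C := 64 * (((i:ℝ)-n*x)^4 + (24 * Real.exp j + ((α+1)^4 + (β*x)^4))) / N^4
  have hle : ((((i+j:ℕ):ℝ) + α) / N) ≤ ((((i+j:ℕ):ℝ) + α + 1) / N) :=
    div_le_div_of_nonneg_right (by linarith) hN.le
  have hb := intervalIntegral.norm_integral_le_of_norm_le_const (a := (((i+j:ℕ):ℝ) + α) / N)
    (b := (((i+j:ℕ):ℝ) + α + 1) / N) (f := fun t => (t-x)^4) (C := C) (by
      intro t ht
      rw [Set.uIoc_of_le hle] at ht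
      obtain ⟨h1, h2⟩ := ht
      rw [div_lt_iff₀ hN] at h1
      rw [le_div_iff₀ hN] at h2
      push_cast at h1 h2
      rw [Real.norm_of_nonneg (by positivity), le_div_iff₀ (by positivity), ← mul_pow]
      set v := t * N - i - j with hv
      have e : (t - x) * N = ((i:ℝ)-n*x) + j + v + (-(β*x)) := by rw [hv, hNd]; ring
      rw [e]
      refine (aux_sum4 _ _ _ _).trans ?_
      have hvv : v^4 ≤ (α+1)^4 := pow_le_pow_left₀ (by linarith) (by linarith) 4
      have hj := Real.pow_div_factorial_le_exp (j:ℝ) (by positivity) 4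
      have hj' : (j:ℝ)^4 ≤ 24 * Real.exp j := by
        rw [div_le_iff₀ (by positivity)] at hj
        norm_num [Nat.factorial] at hj
        linarith
      have : (-(β*x))^4 = (β*x)^4 := by ring
      rw [this]
      linarith)
  have hl : |(((i+j:ℕ):ℝ) + α + 1) / N - (((i+j:ℕ):ℝ) + α) / N| = 1 / N := by
    rw [← sub_div, abs_of_nonneg] <;> ring_nf
    positivity
  rw [hl] at hb
  have := (le_abs_self _).trans hb
  calc _ ≤ N * (C * (1/N)) := by gcongr
    _ = C := by field_simp

lemma aux_main (a : ℝ) (ha : 0 ≤ a) (α β : ℝ) (hα : 0 ≤ α) (hβ : 0 ≤ β) (n : ℕ) (hn : 1 ≤ n)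
    (x : ℝ) (hx : 0 ≤ x) :
    TKS n a α β (fun t => (t - x) ^ 4) x ≤
      64 / ((n:ℝ)+β)^4 * ((3*n^2*x^2*(1+x)^2 + n*x*(1+x)*(1+6*x+6*x^2)) +
        (24 * Real.exp (a * Real.exp 1) + ((α+1)^4 + (β*x)^4))) := by
  have hn' : (1:ℝ) ≤ n := by exact_mod_cast hn
  have hN : 0 < (n:ℝ) + β := by linarith
  have hs : 0 < 1 + x := by positivity
  set A : ℕ → ℝ := fun i => risingFac n i / (i.factorial : ℝ) * (x/(1+x)) ^ i / (1+x)^n with hA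
  set B : ℕ → ℝ := fun j => Real.exp (-(a*x)/(1+x)) * ((a*x/(1+x))^j / (j.factorial : ℝ)) with hB
  set D : ℝ := (α+1)^4 + (β*x)^4 with hD
  have hD0 : 0 ≤ D := by positivity
  have hA0 : ∀ i, 0 ≤ A i := fun i => by
    have := aux_rnn n i
    simp only [hA]; positivity
  have hB0 : ∀ i, 0 ≤ B i := fun i => by simp only [hB]; positivity
  have sA : HasSum A 1 := by
    have h := aux_mom n hn x hx 0
    have e0 : ∀ m, risingFac m 0 = 1 := fun m => by simp [risingFac]
    simp only [e0, mul_one, pow_zero] at h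
    exact h
  have sA4 := aux_four n hn x hx
  have hexp : ∀ z : ℝ, HasSum (fun j : ℕ => z^j / (j.factorial:ℝ)) (Real.exp z) := by
    intro z
    rw [Real.exp_eq_exp_ℝ]
    exact NormedSpace.expSeries_div_hasSum_exp z
  have sB : HasSum B 1 := by
    have := (hexp (a*x/(1+x))).mul_left (Real.exp (-(a*x)/(1+x)))
    rwa [← Real.exp_add, neg_div, neg_add_cancel, Real.exp_zero, ← neg_div] at this
  have sBE : HasSum (fun j => B j * (24 * Real.exp j + D))
      (24 * (Real.exp (-(a*x)/(1+x)) * Real.exp (a*x/(1+x) * Real.exp 1)) + D) := by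
    have := (((hexp (a*x/(1+x) * Real.exp 1)).mul_left (Real.exp (-(a*x)/(1+x)))).mul_left 24).add
      (sB.mul_left D)
    have e1 : (fun j : ℕ => B j * (24 * Real.exp j + D)) = fun b : ℕ =>
        24 * (Real.exp (-(a * x) / (1 + x)) * ((a * x / (1 + x) * Real.exp 1) ^ b /
          (b.factorial : ℝ))) + D * B b := by
      funext j
      simp only [hB]
      rw [mul_pow, ← Real.exp_nat_mul, mul_one]
      ring
    rw [mul_one] at this
    rw [e1]
    exact this
  set S1 := 3*(n:ℝ)^2*x^2*(1+x)^2 + n*x*(1+x)*(1+6*x+6*x^2)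
  set S2 := 24 * (Real.exp (-(a*x)/(1+x)) * Real.exp (a*x/(1+x) * Real.exp 1)) + D with hS2
  have hS2le : S2 ≤ 24 * Real.exp (a * Real.exp 1) + D := by
    have h1 : Real.exp (-(a*x)/(1+x)) ≤ 1 := by
      rw [Real.exp_le_one_iff, neg_div]
      have : 0 ≤ a*x/(1+x) := by positivity
      linarith
    have h2 : Real.exp (a*x/(1+x) * Real.exp 1) ≤ Real.exp (a * Real.exp 1) := by
      apply Real.exp_le_exp.2
      gcongr
      rw [div_le_iff₀ hs]; nlinarith
    have := mul_le_mul h1 h2 (by positivity) zero_le_one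
    rw [hS2]; linarith
  have c1 := hasSum_sum_range_mul_of_summable_norm (f := fun i : ℕ => A i * ((i:ℝ)-n*x)^4) (g := B)
    sA4.summable.norm sB.summable.norm
  have c2 := hasSum_sum_range_mul_of_summable_norm (f := A)
    (g := fun j : ℕ => B j * (24 * Real.exp j + D)) sA.summable.norm sBE.summable.norm
  have t1 : (∑' i : ℕ, A i * ((i:ℝ)-n*x)^4) = S1 := sA4.tsum_eq
  rw [t1, sB.tsum_eq] at c1
  rw [sA.tsum_eq, sBE.tsum_eq] at c2
  have c := (c1.add c2).mul_left (64 / ((n:ℝ)+β)^4)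
  unfold TKS
  rw [← tsum_mul_left]
  have hle : ∀ k : ℕ, ((n:ℝ)+β) * (W n a k x * ∫ t in (((k : ℝ) + α) / ((n : ℝ) + β))..(((k : ℝ) + α + 1) / ((n : ℝ) + β)), (t-x)^4)
      ≤ 64 / ((n:ℝ)+β)^4 * (∑ i ∈ Finset.range (k+1), A i * ((i:ℝ)-n*x)^4 * B (k-i) +
        ∑ i ∈ Finset.range (k+1), A i * (B (k-i) * (24 * Real.exp ((k-i:ℕ):ℝ) + D))) := by
    intro k
    rw [aux_W n a k x hx, mul_left_comm, Finset.sum_mul, ← Finset.sum_add_distrib, Finset.mul_sum]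
    apply Finset.sum_le_sum
    intro i hi
    have hik : i ≤ k := by simpa [Nat.lt_succ_iff] using hi
    obtain ⟨j, rfl⟩ := Nat.exists_eq_add_of_le hik
    rw [Nat.add_sub_cancel_left]
    have h := aux_integral n hn α β x hα hβ i j
    have h' := mul_le_mul_of_nonneg_left h (mul_nonneg (hA0 i) (hB0 j))
    refine h'.trans (le_of_eq ?_)
    ring
  have h0 : ∀ k : ℕ, 0 ≤ ((n:ℝ)+β) * (W n a k x * ∫ t in (((k : ℝ) + α) / ((n : ℝ) + β))..(((k : ℝ) + α + 1) / ((n : ℝ) + β)), (t-x)^4) := by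
    intro k
    apply mul_nonneg hN.le
    apply mul_nonneg
    · rw [aux_W n a k x hx]
      exact Finset.sum_nonneg fun i _ => mul_nonneg (hA0 i) (hB0 _)
    · apply intervalIntegral.integral_nonneg
      · exact div_le_div_of_nonneg_right (by linarith) hN.le
      · intro t _; positivity
  have hsum := Summable.of_nonneg_of_le h0 hle c.summable
  refine (hsum.tsum_le_tsum hle c.summable).trans ?_
  rw [c.tsum_eq, mul_one, one_mul]
  gcongr

theorem Top_fourth_central_moment_bound (a : ℝ) (ha : 0 ≤ a) (α β : ℝ)
    (hα : 0 ≤ α) (hαβ : α ≤ β) :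
    ∃ M : ℝ, 0 < M ∧ ∀ n : ℕ, 1 ≤ n → ∀ x : ℝ, 0 ≤ x →
      TKS n a α β (fun t => (t - x) ^ 4) x ≤
        M * (x ^ 4 + x ^ 3 + x ^ 2 + x + 1) / ((n : ℝ) + β) ^ 2 := by
  have hβ : 0 ≤ β := hα.trans hαβ
  set K := 24 * Real.exp (a * Real.exp 1) + (α+1)^4 with hK
  have hK0 : 0 < K := by positivity
  refine ⟨64 * (20 + K + β^4), by positivity, ?_⟩
  intro n hn x hx
  refine (aux_main a ha α β hα hβ n hn x hx).trans ?_
  have hn' : (1:ℝ) ≤ n := by exact_mod_cast hn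
  have hN : 0 < (n:ℝ) + β := by linarith
  set P := x ^ 4 + x ^ 3 + x ^ 2 + x + 1 with hP
  have hP0 : 0 ≤ P := by positivity
  have hx2 : 0 ≤ x^2 := by positivity
  have hx3 : 0 ≤ x^3 := by positivity
  have hx4 : 0 ≤ x^4 := by positivity
  have hnN : (n:ℝ)^2 ≤ ((n:ℝ)+β)^2 := by gcongr; linarith
  have h1N : (1:ℝ) ≤ ((n:ℝ)+β)^2 := by nlinarith
  have hnN' : (n:ℝ) ≤ ((n:ℝ)+β)^2 := by nlinarith
  have e1 : 3*(n:ℝ)^2*x^2*(1+x)^2 ≤ ((n:ℝ)+β)^2 * (6 * P) := by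
    have : 3*(n:ℝ)^2*x^2*(1+x)^2 = n^2 * (3*x^2*(1+x)^2) := by ring
    rw [this]
    apply mul_le_mul hnN _ (by positivity) (by positivity)
    rw [hP]; nlinarith
  have e2 : (n:ℝ)*x*(1+x)*(1+6*x+6*x^2) ≤ ((n:ℝ)+β)^2 * (14 * P) := by
    have : (n:ℝ)*x*(1+x)*(1+6*x+6*x^2) = n * (x*(1+x)*(1+6*x+6*x^2)) := by ring
    rw [this]
    apply mul_le_mul hnN' _ (by positivity) (by positivity)
    rw [hP]; nlinarith
  have e3 : K + (β*x)^4 ≤ ((n:ℝ)+β)^2 * ((K + β^4) * P) := by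
    have h1 : K + (β*x)^4 ≤ (K + β^4) * P := by
      have q1 : K * 1 ≤ K * P := by gcongr; rw [hP]; linarith
      have q2 : β^4 * x^4 ≤ β^4 * P := by gcongr; rw [hP]; linarith
      rw [mul_pow]; linarith
    have : 0 ≤ (K + β^4) * P := by positivity
    nlinarith
  rw [div_mul_eq_mul_div, div_le_div_iff₀ (by positivity) (by positivity)]
  have e := add_le_add (add_le_add e1 e2) e3
  have e' := mul_le_mul_of_nonneg_left e (show (0:ℝ) ≤ 64 * ((n:ℝ)+β)^2 by positivity)
  rw [hK] at e' ⊢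
  linarith
end

section
/- Fix reals a ≥ 0 and 0 ≤ α ≤ β. There exists a constant M = M(a,α,β) > 0, independent of n and f, such that for every integer n ≥ 1 and every continuous f : [0,∞) → ℝ with |f(x)| ≤ M_f·(1+x²) for some constant M_f and lim_{x→∞} f(x)/(1+x²) existing and finite: sup_{x≥0} |T_{n,a}^{α,β}(f;x) − f(x)| / (1+x²)³ ≤ M·Ω(f; (n+β)^{−1/2}). -/
open MeasureTheory Filter

/-- First modulus of continuity on `[0,∞)`. -/
noncomputable def omega1 (f : ℝ → ℝ) (δ : ℝ) : ℝ :=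
  sSup {y | ∃ h x : ℝ, 0 < h ∧ h ≤ δ ∧ 0 ≤ x ∧ y = |f (x + h) - f x|}

/-- Second modulus of continuity on `[0,∞)`. -/
noncomputable def omega2 (f : ℝ → ℝ) (δ : ℝ) : ℝ :=
  sSup {y | ∃ h x : ℝ, 0 < h ∧ h ≤ δ ∧ 0 ≤ x ∧ y = |f (x + 2 * h) - 2 * f (x + h) + f x|}

/-- Weighted modulus of continuity `Ω(f;δ)`. -/
noncomputable def OmegaW (f : ℝ → ℝ) (δ : ℝ) : ℝ :=
  sSup {y | ∃ h x : ℝ, 0 < h ∧ h ≤ δ ∧ 0 ≤ x ∧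
    y = |f (x + h) - f x| / ((1 + h ^ 2) * (1 + x ^ 2))}

lemma chain_step (f : ℝ → ℝ) (Om δ : ℝ) (hO : 0 ≤ Om) (hδ1 : δ ≤ 1)
    (P : ∀ h x : ℝ, 0 < h → h ≤ δ → 0 ≤ x → |f (x + h) - f x| ≤ Om * ((1 + h ^ 2) * (1 + x ^ 2)))
    (s h : ℝ) (hs : 0 ≤ s) (hh : 0 < h) (hhδ : h ≤ δ) (j : ℕ) :
    |f (s + j * h) - f s| ≤ j * (2 * (1 + (s + j * h) ^ 2) * Om) := by
  induction j with
  | zero => simp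
  | succ j ih =>
    have hp : 0 ≤ s + j * h := by positivity
    have h1 := P h (s + j * h) hh hhδ hp
    have e : s + ((j + 1 : ℕ) : ℝ) * h = s + j * h + h := by push_cast; ring
    rw [e]
    set p := s + j * h
    have h2 : |f (p + h) - f s| ≤ |f (p + h) - f p| + |f p - f s| := abs_sub_le _ _ _
    have h3 : Om * ((1 + h ^ 2) * (1 + p ^ 2)) ≤ 2 * (1 + (p + h) ^ 2) * Om := by
      have : (1 + h ^ 2) * (1 + p ^ 2) ≤ 2 * (1 + (p + h) ^ 2) := by
        apply mul_le_mul <;> nlinarith [mul_nonneg hp hh.le, sq_nonneg h]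
      nlinarith
    have h4 : (j : ℝ) * (2 * (1 + p ^ 2) * Om) ≤ j * (2 * (1 + (p + h) ^ 2) * Om) := by
      have : p ^ 2 ≤ (p + h) ^ 2 := by nlinarith [mul_nonneg hp hh.le, sq_nonneg h]
      gcongr
    push_cast
    linarith

lemma chain_bound (f : ℝ → ℝ) (Om δ : ℝ) (hO : 0 ≤ Om) (hδ : 0 < δ) (hδ1 : δ ≤ 1)
    (P : ∀ h x : ℝ, 0 < h → h ≤ δ → 0 ≤ x → |f (x + h) - f x| ≤ Om * ((1 + h ^ 2) * (1 + x ^ 2)))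
    (s t : ℝ) (hs : 0 ≤ s) (hst : s ≤ t) :
    |f t - f s| ≤ (1 + (t - s) / δ) * (2 * (1 + t ^ 2) * Om) := by
  rcases hst.eq_or_lt with rfl | hlt
  · simp; positivity
  · have hd : 0 < t - s := sub_pos.2 hlt
    have hq : 0 < (t - s) / δ := by positivity
    set m := ⌈(t - s) / δ⌉₊ with hm
    have hm0 : 0 < m := Nat.ceil_pos.2 hq
    have hmr : (0 : ℝ) < m := by exact_mod_cast hm0
    have hle : (t - s) / δ ≤ m := Nat.le_ceil _
    have hlt' : (m : ℝ) < (t - s) / δ + 1 := Nat.ceil_lt_add_one hq.le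
    have hhδ : (t - s) / m ≤ δ := by
      rw [div_le_iff₀ hδ] at hle
      rw [div_le_iff₀ hmr]; linarith
    have := chain_step f Om δ hO hδ1 P s ((t - s) / m) hs (by positivity) hhδ m
    have e : s + m * ((t - s) / m) = t := by field_simp; ring
    rw [e] at this
    refine this.trans ?_
    have h0 : 0 ≤ 2 * (1 + t ^ 2) * Om := by positivity
    exact mul_le_mul_of_nonneg_right (by linarith) h0

lemma key_bound (f : ℝ → ℝ) (Om δ N : ℝ) (hO : 0 ≤ Om) (hδ : 0 < δ) (hδ1 : δ ≤ 1)
    (hN : δ ^ 2 * N = 1)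
    (P : ∀ h x : ℝ, 0 < h → h ≤ δ → 0 ≤ x → |f (x + h) - f x| ≤ Om * ((1 + h ^ 2) * (1 + x ^ 2)))
    (x t : ℝ) (hx : 0 ≤ x) (ht : 0 ≤ t) :
    |f t - f x| ≤ 16 * (1 + x ^ 2) * Om * (1 + N ^ 2 * (t - x) ^ 4) := by
  have main : |f t - f x| ≤
      (1 + |t - x| / δ) * (2 * (2 * (1 + x ^ 2) * (1 + (t - x) ^ 2)) * Om) := by
    rcases le_total x t with h | h
    · have := chain_bound f Om δ hO hδ hδ1 P x t hx h
      rw [abs_of_nonneg (sub_nonneg.2 h)]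
      refine this.trans ?_
      have h1 : 0 ≤ t - x := sub_nonneg.2 h
      gcongr
      nlinarith [sq_nonneg (t - 2 * x), sq_nonneg (x * (t - x))]
    · have := chain_bound f Om δ hO hδ hδ1 P t x ht h
      rw [abs_sub_comm (f t), abs_sub_comm t]
      rw [abs_of_nonneg (sub_nonneg.2 h)]
      refine this.trans ?_
      have h1 : 0 ≤ x - t := sub_nonneg.2 h
      gcongr
      nlinarith [sq_nonneg (t - x), sq_nonneg (x * (t - x))]
  refine main.trans ?_
  set v := |t - x| / δ with hv
  have hv0 : 0 ≤ v := by positivity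
  have hu : |t - x| = v * δ := by rw [hv]; field_simp
  have hu2 : (t - x) ^ 2 = v ^ 2 * δ ^ 2 := by rw [← sq_abs, hu]; ring
  have hu4 : N ^ 2 * (t - x) ^ 4 = v ^ 4 := by
    have : N ^ 2 * (t - x) ^ 4 = v ^ 4 * (δ ^ 2 * N) ^ 2 := by
      rw [show (t - x) ^ 4 = ((t - x) ^ 2) ^ 2 by ring, hu2]; ring
    rw [this, hN]; ring
  rw [hu4]
  have h1 : (t - x) ^ 2 ≤ v ^ 2 := by
    rw [hu2]; exact mul_le_of_le_one_right (by positivity) (by nlinarith)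
  have h2 : (1 + v) * (1 + (t - x) ^ 2) ≤ 4 * (1 + v ^ 4) := by
    have : (1 + v) * (1 + (t - x) ^ 2) ≤ (1 + v) * (1 + v ^ 2) := by gcongr
    nlinarith [sq_nonneg (v ^ 2 - 1), sq_nonneg (v - 1), sq_nonneg (v ^ 2 - v)]
  have h3 : 0 ≤ 4 * (1 + x ^ 2) * Om := by positivity
  calc _ = 4 * (1 + x ^ 2) * Om * ((1 + v) * (1 + (t - x) ^ 2)) := by ring
    _ ≤ 4 * (1 + x ^ 2) * Om * (4 * (1 + v ^ 4)) := by gcongr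
    _ = _ := by ring

lemma omega_prop (f : ℝ → ℝ) (δ Mf : ℝ) (hf : ∀ x : ℝ, 0 ≤ x → |f x| ≤ Mf * (1 + x ^ 2)) :
    0 ≤ OmegaW f δ ∧ ∀ h x : ℝ, 0 < h → h ≤ δ → 0 ≤ x →
      |f (x + h) - f x| ≤ OmegaW f δ * ((1 + h ^ 2) * (1 + x ^ 2)) := by
  have hM : 0 ≤ Mf := by have := (abs_nonneg _).trans (hf 0 le_rfl); simpa using this
  constructor
  · apply Real.sSup_nonneg
    rintro y ⟨h, x, _, _, _, rfl⟩
    positivity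
  · intro h x hh hhδ hx
    rw [← div_le_iff₀ (by positivity)]
    refine le_csSup ⟨3 * Mf, ?_⟩ ⟨h, x, hh, hhδ, hx, rfl⟩
    rintro y ⟨h, x, hh, _, hx, rfl⟩
    rw [div_le_iff₀ (by positivity)]
    have h1 := hf x hx
    have h2 := hf (x + h) (by positivity)
    have h3 : |f (x + h) - f x| ≤ |f (x + h)| + |f x| := abs_sub _ _
    have h4 : (1 + (x + h) ^ 2) + (1 + x ^ 2) ≤ 3 * ((1 + h ^ 2) * (1 + x ^ 2)) := by
      nlinarith [sq_nonneg (x - h), sq_nonneg (x * h), sq_nonneg x, sq_nonneg h]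
    nlinarith

lemma delta_prop (N : ℝ) (hN : 1 ≤ N) :
    0 < N ^ (-(1 : ℝ) / 2) ∧ N ^ (-(1 : ℝ) / 2) ≤ 1 ∧ (N ^ (-(1 : ℝ) / 2)) ^ 2 * N = 1 := by
  have h0 : 0 < N := by linarith
  refine ⟨by positivity, Real.rpow_le_one_of_one_le_of_nonpos hN (by norm_num), ?_⟩
  rw [← Real.rpow_natCast, ← Real.rpow_mul h0.le]
  norm_num [Real.rpow_neg_one]
  field_simp

lemma hasSum_cauchy {f g : ℕ → ℝ} {A B : ℝ} (hf0 : ∀ i, 0 ≤ f i) (hg0 : ∀ i, 0 ≤ g i)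
    (hf : HasSum f A) (hg : HasSum g B) :
    HasSum (fun k => ∑ p ∈ Finset.HasAntidiagonal.antidiagonal k, f p.1 * g p.2) (A * B) := by
  have hf' : Summable fun x => ‖f x‖ := by
    simpa [Real.norm_eq_abs, abs_of_nonneg (hf0 _)] using hf.summable.abs
  have hg' : Summable fun x => ‖g x‖ := by
    simpa [Real.norm_eq_abs, abs_of_nonneg (hg0 _)] using hg.summable.abs
  have h1 := tsum_mul_tsum_eq_tsum_sum_antidiagonal_of_summable_norm hf' hg'
  rw [hf.tsum_eq, hg.tsum_eq] at h1
  rw [h1]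
  exact (summable_norm_sum_mul_antidiagonal_of_summable_norm hf' hg').of_norm.hasSum

/-- negative binomial weights, `n = m+1`. -/
noncomputable def nbw (m : ℕ) (z : ℝ) (i : ℕ) : ℝ :=
  (1 - z) ^ (m + 1) * (((i + m).choose m : ℝ) * z ^ i)

/-- Poisson weights. -/
noncomputable def pow' (l : ℝ) (j : ℕ) : ℝ := Real.exp (-l) * (l ^ j / (j.factorial : ℝ))

lemma choose_shift (i N : ℕ) :
    ((i + N).choose N : ℝ) * ((i : ℝ) + N + 1) = ((i + (N + 1)).choose (N + 1) : ℝ) * (N + 1) := by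
  have h := Nat.add_one_mul_choose_eq (i + N) N
  have h' : ((i + N + 1 : ℕ) : ℝ) * ((i + N).choose N : ℝ)
    = ((i + N + 1).choose (N + 1) : ℝ) * ((N + 1 : ℕ) : ℝ) := by exact_mod_cast h
  push_cast at h'
  rw [← add_assoc i N 1, ← h']; ring

lemma nb_asc (m : ℕ) (z : ℝ) (hz0 : 0 ≤ z) (hz1 : z < 1) (r : ℕ) :
    HasSum (fun i : ℕ => nbw m z i * ∏ j ∈ Finset.range r, ((i : ℝ) + m + 1 + j))
      ((∏ j ∈ Finset.range r, ((m : ℝ) + 1 + j)) * (1 / (1 - z)) ^ r) := by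
  have hz : ‖z‖ < 1 := by rw [Real.norm_eq_abs, abs_of_nonneg hz0]; exact hz1
  have h1z : 1 - z ≠ 0 := by linarith
  have h := (hasSum_choose_mul_geometric_of_norm_lt_one (m + r) hz).mul_left
    ((1 - z) ^ (m + 1) * ∏ j ∈ Finset.range r, ((m : ℝ) + 1 + j))
  have key : ∀ i : ℕ, ((i + m).choose m : ℝ) * ∏ j ∈ Finset.range r, ((i : ℝ) + m + 1 + j)
      = ((i + (m + r)).choose (m + r) : ℝ) * ∏ j ∈ Finset.range r, ((m : ℝ) + 1 + j) := by
    intro i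
    clear h
    induction r with
    | zero => simp
    | succ r ih =>
      rw [Finset.prod_range_succ, Finset.prod_range_succ, ← mul_assoc, ih]
      have := choose_shift i (m + r)
      push_cast at this
      rw [← add_assoc m r 1]
      linear_combination (∏ j ∈ Finset.range r, ((m : ℝ) + 1 + j)) * this
  convert! h using 1
  · ext i
    unfold nbw
    linear_combination ((1 - z) ^ (m + 1) * z ^ i) * key i
  · rw [show m + r + 1 = (m + 1) + r by ring, pow_add, one_div, one_div, inv_pow]
    field_simp
    ring

lemma nb_four (m : ℕ) (x : ℝ) (hx : 0 ≤ x) :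
    HasSum (fun i : ℕ => nbw m (x / (1 + x)) i) 1 ∧
    HasSum (fun i : ℕ => nbw m (x / (1 + x)) i * ((i : ℝ) - (m + 1) * x) ^ 4)
      (3 * (m + 1) ^ 2 * x ^ 2 * (1 + x) ^ 2 + (m + 1) * x * (1 + x) * (1 + 6 * x * (1 + x))) := by
  have hy : 0 < 1 + x := by linarith
  have hz0 : 0 ≤ x / (1 + x) := by positivity
  have hz1 : x / (1 + x) < 1 := by rw [div_lt_one hy]; linarith
  have e : 1 / (1 - x / (1 + x)) = 1 + x := by field_simp; ring
  have h := nb_asc m _ hz0 hz1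
  rw [e] at h
  have h0 := h 0
  have h1 := h 1
  have h2 := h 2
  have h3 := h 3
  have h4 := h 4
  simp only [Finset.prod_range_succ, Finset.prod_range_zero] at h0 h1 h2 h3 h4
  push_cast at h0 h1 h2 h3 h4
  refine ⟨by simpa using h0, ?_⟩
  set c : ℝ := ((m : ℝ) + 1) * (1 + x) with hc
  -- Y^4 - 4cY^3 + 6c^2Y^2 - 4c^3 Y + c^4
  have := (((h4.add (h3.mul_left (-6 - 4 * c))).add
    (h2.mul_left (7 + 12 * c + 6 * c ^ 2))).add
    (h1.mul_left (-1 - 4 * c - 6 * c ^ 2 - 4 * c ^ 3))).add (h0.mul_left (c ^ 4))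
  convert! this using 1
  · ext i
    rw [hc]
    ring
  · rw [hc]
    ring

lemma poi_one (l : ℝ) : HasSum (fun j => pow' l j) 1 := by
  have h := (NormedSpace.expSeries_div_hasSum_exp l).mul_left (Real.exp (-l))
  rw [← Real.exp_eq_exp_ℝ, ← Real.exp_add] at h
  simpa [pow'] using h

lemma poi_four (l a : ℝ) (hl : 0 ≤ l) (hla : l ≤ a) :
    ∃ B, B ≤ 24 * Real.exp (Real.exp 1 * a) ∧ HasSum (fun j : ℕ => pow' l j * (j : ℝ) ^ 4) B := by
  have h := (NormedSpace.expSeries_div_hasSum_exp (Real.exp 1 * l)).mul_left 24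
  rw [← Real.exp_eq_exp_ℝ] at h
  have hle : ∀ j : ℕ, pow' l j * (j : ℝ) ^ 4 ≤
      24 * ((Real.exp 1 * l) ^ j / (j.factorial : ℝ)) := by
    intro j
    have h1 := Real.pow_div_factorial_le_exp (j : ℝ) (Nat.cast_nonneg j) 4
    have h2 : (j : ℝ) ^ 4 ≤ 24 * Real.exp 1 ^ j := by
      rw [← Real.exp_nat_mul, mul_one]
      norm_num [Nat.factorial] at h1
      linarith
    have h3 : Real.exp (-l) ≤ 1 := Real.exp_le_one_iff.2 (by linarith)
    have h4 : 0 ≤ l ^ j / (j.factorial : ℝ) := by positivity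
    unfold pow'
    calc _ ≤ (1 * (l ^ j / (j.factorial : ℝ))) * (24 * Real.exp 1 ^ j) := by gcongr
      _ = _ := by rw [mul_pow]; ring
  have hs : Summable (fun j : ℕ => pow' l j * (j : ℝ) ^ 4) :=
    Summable.of_nonneg_of_le (fun j => by unfold pow'; positivity) hle h.summable
  refine ⟨_, ?_, hs.hasSum⟩
  refine (hasSum_le hle hs.hasSum h).trans ?_
  gcongr

lemma W_eq (m : ℕ) (a x : ℝ) (hx : 0 ≤ x) (k : ℕ) :
    W (m + 1) a k x = ∑ p ∈ Finset.HasAntidiagonal.antidiagonal k,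
      nbw m (x / (1 + x)) p.1 * pow' (a * (x / (1 + x))) p.2 := by
  have hy : 1 + x ≠ 0 := by positivity
  rw [Finset.Nat.sum_antidiagonal_eq_sum_range_succ
    (fun i j => nbw m (x / (1 + x)) i * pow' (a * (x / (1 + x))) j)]
  unfold W pCoef
  have hr : Real.exp (-(a * x) / (1 + x)) *
      ((∑ i ∈ Finset.range (k + 1), (k.choose i : ℝ) * risingFac (m + 1) i * a ^ (k - i)) /
        (k.factorial : ℝ)) * x ^ k / (1 + x) ^ (k + (m + 1)) =
      ∑ i ∈ Finset.range (k + 1), (k.choose i : ℝ) * risingFac (m + 1) i * a ^ (k - i) *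
       (Real.exp (-(a * x) / (1 + x)) / (k.factorial : ℝ) * x ^ k / (1 + x) ^ (k + (m + 1))) := by
    rw [← Finset.sum_mul]; ring
  rw [hr]
  refine Finset.sum_congr rfl fun i hi => ?_
  have hik : i ≤ k := Nat.lt_succ_iff.1 (Finset.mem_range.1 hi)
  have h1 : risingFac (m + 1) i = (i.factorial : ℝ) * ((i + m).choose m : ℝ) := by
    have := Nat.ascFactorial_eq_factorial_mul_choose m i
    rw [Nat.ascFactorial_eq_prod_range] at this
    unfold risingFac
    rw [add_comm i m, Nat.choose_symm_add]
    exact_mod_cast this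
  have h2 : (k.choose i : ℝ) * (i.factorial : ℝ) / (k.factorial : ℝ)
      = 1 / ((k - i).factorial : ℝ) := by
    have := Nat.choose_mul_factorial_mul_factorial hik
    have h : (k.choose i : ℝ) * (i.factorial : ℝ) * ((k - i).factorial : ℝ) = k.factorial := by
      exact_mod_cast this
    have p1 : ((k - i).factorial : ℝ) ≠ 0 := by positivity
    have p2 : (k.factorial : ℝ) ≠ 0 := by positivity
    rw [div_eq_div_iff p2 p1]; linarith
  have h3 : (1 - x / (1 + x)) = 1 / (1 + x) := by field_simp; ring
  have h4 : (x / (1 + x)) ^ i * (x / (1 + x)) ^ (k - i) = x ^ k / (1 + x) ^ k := by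
    rw [← pow_add, Nat.add_sub_cancel' hik, div_pow]
  unfold nbw pow'
  rw [h1, h3, mul_pow, show -(a * (x / (1 + x))) = -(a * x) / (1 + x) by ring]
  calc _ = ((k.choose i : ℝ) * (i.factorial : ℝ) / (k.factorial : ℝ)) * ((i + m).choose m : ℝ)
        * a ^ (k - i) * Real.exp (-(a * x) / (1 + x)) * (x ^ k / (1 + x) ^ (k + (m + 1))) := by ring
    _ = (1 / ((k - i).factorial : ℝ)) * ((i + m).choose m : ℝ)
        * a ^ (k - i) * Real.exp (-(a * x) / (1 + x)) *
          ((x ^ k / (1 + x) ^ k) * (1 / (1 + x)) ^ (m + 1)) := by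
        rw [h2, pow_add (1 + x) k, one_div_pow (1 + x)]; congr 1; field_simp
    _ = _ := by rw [← h4]; ring

lemma W_moments (m : ℕ) (a x : ℝ) (ha : 0 ≤ a) (hx : 0 ≤ x) :
    (∀ k, 0 ≤ W (m + 1) a k x) ∧ HasSum (fun k => W (m + 1) a k x) 1 ∧
    ∃ S, S ≤ 8 * (38 * (m + 1) ^ 2 * (1 + x ^ 2) ^ 2 + 24 * Real.exp (Real.exp 1 * a)) ∧
      HasSum (fun k : ℕ => W (m + 1) a k x * ((k : ℝ) - (m + 1) * x) ^ 4) S := by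
  have hy : 0 < 1 + x := by linarith
  have hz0 : 0 ≤ x / (1 + x) := by positivity
  have hz1 : x / (1 + x) < 1 := by rw [div_lt_one hy]; linarith
  have hn0 : ∀ i, 0 ≤ nbw m (x / (1 + x)) i := fun i => by
    unfold nbw; have : 0 ≤ 1 - x / (1 + x) := by linarith
    positivity
  set l := a * (x / (1 + x)) with hl
  have hl0 : 0 ≤ l := by positivity
  have hla : l ≤ a := mul_le_of_le_one_right ha hz1.le
  have hp0 : ∀ j, 0 ≤ pow' l j := fun j => by unfold pow'; positivity
  have hW0 : ∀ k, 0 ≤ W (m + 1) a k x := fun k => by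
    rw [W_eq m a x hx]
    exact Finset.sum_nonneg fun p _ => mul_nonneg (hn0 _) (hp0 _)
  obtain ⟨hn1, hn4⟩ := nb_four m x hx
  obtain ⟨B, hB, hp4⟩ := poi_four l a hl0 hla
  have hp1 := poi_one l
  refine ⟨hW0, ?_, ?_⟩
  · have := hasSum_cauchy hn0 hp0 hn1 hp1
    rw [one_mul] at this
    simpa only [W_eq m a x hx] using this
  · have e4 : ∀ t : ℝ, 0 ≤ t ^ 4 := fun t => by positivity
    have s1 := hasSum_cauchy (fun i => mul_nonneg (hn0 i) (e4 _)) hp0 hn4 hp1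
    have s2 := hasSum_cauchy hn0 (fun i => mul_nonneg (hp0 i) (e4 _)) hn1 hp4
    have s := (s1.add s2).mul_left 8
    have hle : ∀ k : ℕ, W (m + 1) a k x * ((k : ℝ) - (m + 1) * x) ^ 4 ≤ _ := fun k => by
      have : W (m + 1) a k x * ((k : ℝ) - (m + 1) * x) ^ 4 ≤
        8 * (∑ p ∈ Finset.HasAntidiagonal.antidiagonal k,
          nbw m (x / (1 + x)) p.1 * ((p.1 : ℝ) - (m + 1) * x) ^ 4 * pow' l p.2 +
          ∑ p ∈ Finset.HasAntidiagonal.antidiagonal k,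
            nbw m (x / (1 + x)) p.1 * (pow' l p.2 * (p.2 : ℝ) ^ 4)) := by
        rw [W_eq m a x hx, Finset.sum_mul, ← Finset.sum_add_distrib, Finset.mul_sum]
        refine Finset.sum_le_sum fun p hp => ?_
        have hk : (k : ℝ) = p.1 + p.2 := by exact_mod_cast (Finset.HasAntidiagonal.mem_antidiagonal.1 hp).symm
        rw [hk]
        have h8 : ∀ u v : ℝ, (u + v) ^ 4 ≤ 8 * (u ^ 4 + v ^ 4) := fun u v => by
          nlinarith [sq_nonneg (u ^ 2 - v ^ 2), sq_nonneg (u - v), sq_nonneg (u + v),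
            mul_nonneg (sq_nonneg (u - v)) (sq_nonneg (u + v)), sq_nonneg ((u - v) ^ 2)]
        have h9 := h8 ((p.1 : ℝ) - (m + 1) * x) p.2
        have hw := mul_nonneg (hn0 p.1) (hp0 p.2)
        have h10 := mul_le_mul_of_nonneg_left h9 hw
        rw [show ((p.1 : ℝ) + p.2 - (m + 1) * x) = (p.1 : ℝ) - (m + 1) * x + p.2 by ring]
        refine h10.trans (le_of_eq ?_)
        ring
      exact this
    have hs := Summable.of_nonneg_of_le (fun k => mul_nonneg (hW0 k) (e4 _)) hle s.summable
    refine ⟨_, ?_, hs.hasSum⟩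
    refine (hasSum_le hle hs.hasSum s).trans ?_
    rw [mul_one, one_mul]
    have hm : (1 : ℝ) ≤ (m : ℝ) + 1 := by linarith [(Nat.cast_nonneg m : (0 : ℝ) ≤ m)]
    have hq : x * (1 + x) ≤ 2 * (1 + x ^ 2) := by nlinarith [sq_nonneg (x - 1)]
    have hq0 : 0 ≤ x * (1 + x) := by positivity
    have hq1 : x * (1 + x) ≤ 2 * (1 + x ^ 2) ^ 2 := by nlinarith [sq_nonneg x, sq_nonneg (x ^ 2)]
    have hq2 : (x * (1 + x)) ^ 2 ≤ 4 * (1 + x ^ 2) ^ 2 := by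
      calc _ ≤ (2 * (1 + x ^ 2)) ^ 2 := by gcongr
        _ = _ := by ring
    have hm2 : (m : ℝ) + 1 ≤ ((m : ℝ) + 1) ^ 2 := by nlinarith
    set q := x * (1 + x)
    have : 3 * ((m : ℝ) + 1) ^ 2 * x ^ 2 * (1 + x) ^ 2 +
        (m + 1) * x * (1 + x) * (1 + 6 * x * (1 + x)) ≤ 38 * (m + 1) ^ 2 * (1 + x ^ 2) ^ 2 := by
      calc _ = 3 * ((m : ℝ) + 1) ^ 2 * q ^ 2 + ((m : ℝ) + 1) * (q + 6 * q ^ 2) := by ring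
        _ ≤ 3 * ((m : ℝ) + 1) ^ 2 * (4 * (1 + x ^ 2) ^ 2) + ((m : ℝ) + 1) ^ 2 *
            (2 * (1 + x ^ 2) ^ 2 + 6 * (4 * (1 + x ^ 2) ^ 2)) := by gcongr
        _ = _ := by ring
    linarith

lemma h27 (u v w : ℝ) : (u + v + w) ^ 4 ≤ 27 * (u ^ 4 + v ^ 4 + w ^ 4) := by
  have q : (u + v + w) ^ 2 ≤ 3 * (u ^ 2 + v ^ 2 + w ^ 2) := by
    nlinarith [sq_nonneg (u - v), sq_nonneg (v - w), sq_nonneg (u - w)]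
  calc (u + v + w) ^ 4 = ((u + v + w) ^ 2) ^ 2 := by ring
    _ ≤ (3 * (u ^ 2 + v ^ 2 + w ^ 2)) ^ 2 := by gcongr
    _ ≤ _ := by nlinarith [sq_nonneg (u ^ 2 - v ^ 2), sq_nonneg (v ^ 2 - w ^ 2),
        sq_nonneg (u ^ 2 - w ^ 2)]

set_option maxHeartbeats 1600000 in
theorem main_pointwise (a : ℝ) (ha : 0 ≤ a) (α β : ℝ) (hα : 0 ≤ α) (hαβ : α ≤ β) (m : ℕ)
    (f : ℝ → ℝ) (hf : ContinuousOn f (Set.Ici 0)) (Om δ : ℝ) (hO : 0 ≤ Om)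
    (hδ : 0 < δ) (hδ1 : δ ≤ 1) (hN : δ ^ 2 * (((m + 1 : ℕ) : ℝ) + β) = 1)
    (P : ∀ h x : ℝ, 0 < h → h ≤ δ → 0 ≤ x → |f (x + h) - f x| ≤ Om * ((1 + h ^ 2) * (1 + x ^ 2)))
    (x : ℝ) (hx : 0 ≤ x) :
    |TKS (m + 1) a α β f x - f x| ≤ (16 * (1 + 27 * (8 * (38 + 24 * Real.exp (Real.exp 1 * a)) +
      (α + 1) ^ 4 + β ^ 4))) * Om * (1 + x ^ 2) ^ 3 := by
  obtain ⟨hW0, hW1, S, hS, hW4⟩ := W_moments m a x ha hx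
  unfold TKS
  set N : ℝ := ((m + 1 : ℕ) : ℝ) + β with hNdef
  have hm0 : (0 : ℝ) ≤ m := Nat.cast_nonneg m
  have hβ : 0 ≤ β := hα.trans hαβ
  have hnN : (m : ℝ) + 1 ≤ N := by rw [hNdef]; push_cast; linarith
  have hN1 : 1 ≤ N := by linarith
  have hN0 : 0 < N := by linarith
  set I : ℕ → ℝ := fun k => ∫ t in (((k : ℝ) + α) / N)..(((k : ℝ) + α + 1) / N), f t with hI
  set D : ℕ → ℝ := fun k => 16 * (1 + x ^ 2) * Om *
    (1 + 27 / N ^ 2 * (((k : ℝ) - (m + 1) * x) ^ 4 + (α + 1) ^ 4 + β ^ 4 * x ^ 4)) with hD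
  have hbound : ∀ k, |N * I k - f x| ≤ D k := by
    intro k
    have hk0 : (0 : ℝ) ≤ k := Nat.cast_nonneg k
    have hlt : ((k : ℝ) + α) / N ≤ ((k : ℝ) + α + 1) / N := 
      div_le_div_of_nonneg_right (by linarith) hN0.le
    have hlen : ((k : ℝ) + α + 1) / N - ((k : ℝ) + α) / N = 1 / N := by ring
    have hl0 : 0 ≤ ((k : ℝ) + α) / N := by positivity
    have hint : IntervalIntegrable f volume (((k : ℝ) + α) / N) (((k : ℝ) + α + 1) / N) := by
      apply ContinuousOn.intervalIntegrable
      apply hf.mono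
      rw [Set.uIcc_of_le hlt]
      intro t ht
      exact hl0.trans ht.1
    have e1 : N * I k - f x =
        N * ∫ t in (((k : ℝ) + α) / N)..(((k : ℝ) + α + 1) / N), (f t - f x) := by
      rw [intervalIntegral.integral_sub hint (by simp), intervalIntegral.integral_const, hlen]
      simp only [hI, smul_eq_mul]
      field_simp
    have h2 : ‖∫ t in (((k : ℝ) + α) / N)..(((k : ℝ) + α + 1) / N), (f t - f x)‖ ≤
        D k * |((k : ℝ) + α + 1) / N - ((k : ℝ) + α) / N| := by
      apply intervalIntegral.norm_integral_le_of_norm_le_const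
      intro t ht
      rw [Set.uIoc_of_le hlt] at ht
      have ht0 : 0 ≤ t := hl0.trans ht.1.le
      have b := key_bound f Om δ N hO hδ hδ1 hN P x t hx ht0
      rw [Real.norm_eq_abs]
      refine b.trans ?_
      simp only [hD]
      have hNt1 : (k : ℝ) + α < t * N := (div_lt_iff₀ hN0).1 ht.1
      have hNt2 : t * N ≤ (k : ℝ) + α + 1 := (le_div_iff₀ hN0).1 ht.2
      have hq := h27 ((k : ℝ) - (m + 1) * x) (t * N - k) (-(β * x))
      have e2 : (k : ℝ) - (m + 1) * x + (t * N - k) + -(β * x) = N * (t - x) := by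
        rw [hNdef]; push_cast; ring
      rw [e2] at hq
      have hc : (t * N - k) ^ 4 ≤ (α + 1) ^ 4 := by
        apply pow_le_pow_left₀ <;> linarith
      have e3 : N ^ 2 * (t - x) ^ 4 = (N * (t - x)) ^ 4 / N ^ 2 := by field_simp
      rw [e3, div_mul_eq_mul_div]
      gcongr 16 * (1 + x ^ 2) * Om * (1 + ?_ / N ^ 2)
      refine hq.trans ?_
      have : (-(β * x)) ^ 4 = β ^ 4 * x ^ 4 := by ring
      rw [this]
      linarith
    rw [Real.norm_eq_abs, hlen, abs_of_pos (by positivity : 0 < 1 / N)] at h2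
    rw [e1, abs_mul, abs_of_pos hN0]
    calc _ ≤ N * (D k * (1 / N)) := by gcongr
      _ = D k := by field_simp
  have hWD : HasSum (fun k => W (m + 1) a k x * D k)
      (16 * (1 + x ^ 2) * Om * (1 + 27 / N ^ 2 * (S + (α + 1) ^ 4 + β ^ 4 * x ^ 4))) := by
    have := ((hW1.mul_left (1 + 27 / N ^ 2 * ((α + 1) ^ 4 + β ^ 4 * x ^ 4))).add
      (hW4.mul_left (27 / N ^ 2))).mul_left (16 * (1 + x ^ 2) * Om)
    convert! this using 1
    · ext k; simp only [hD]; ring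
    · ring
  have hle : ∀ k, ‖W (m + 1) a k x * (N * I k - f x)‖ ≤ W (m + 1) a k x * D k := by
    intro k
    rw [norm_mul, Real.norm_eq_abs, Real.norm_eq_abs, abs_of_nonneg (hW0 k)]
    exact mul_le_mul_of_nonneg_left (hbound k) (hW0 k)
  have hs : Summable fun k => W (m + 1) a k x * (N * I k - f x) :=
    Summable.of_norm_bounded hWD.summable hle
  have heq : N * ∑' k, W (m + 1) a k x * I k - f x =
      ∑' k, W (m + 1) a k x * (N * I k - f x) := by
    have h1 := hs.hasSum.add (hW1.mul_right (f x))
    have h2 := h1.tsum_eq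
    rw [← tsum_mul_left]
    have : ∀ k, N * (W (m + 1) a k x * I k) =
      W (m + 1) a k x * (N * I k - f x) + W (m + 1) a k x * f x := fun k => by ring
    simp only [this]
    rw [h2]; ring
  rw [heq]
  refine (tsum_of_norm_bounded hWD hle).trans ?_
  have hE : 0 < Real.exp (Real.exp 1 * a) := Real.exp_pos _
  set E := Real.exp (Real.exp 1 * a)
  set y := 1 + x ^ 2 with hy
  have hy1 : 1 ≤ y := by nlinarith [sq_nonneg x]
  have hy2 : 1 ≤ y ^ 2 := one_le_pow₀ hy1
  have hx4 : x ^ 4 ≤ y ^ 2 := by rw [hy]; nlinarith [sq_nonneg x]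
  have hN2 : 1 ≤ N ^ 2 := one_le_pow₀ hN1
  have hNy : 1 ≤ N ^ 2 * y ^ 2 := one_le_mul_of_one_le_of_one_le hN2 hy2
  have hyNy : y ^ 2 ≤ N ^ 2 * y ^ 2 := le_mul_of_one_le_left (by positivity) hN2
  have hmN : ((m : ℝ) + 1) ^ 2 ≤ N ^ 2 := by gcongr
  have hfin : S + (α + 1) ^ 4 + β ^ 4 * x ^ 4 ≤
      (8 * (38 + 24 * E) + (α + 1) ^ 4 + β ^ 4) * (N ^ 2 * y ^ 2) := by
    have t1 : 38 * ((m : ℝ) + 1) ^ 2 * y ^ 2 ≤ 38 * N ^ 2 * y ^ 2 := by gcongr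
    have t2 : 24 * E ≤ 24 * E * (N ^ 2 * y ^ 2) := le_mul_of_one_le_right (by positivity) hNy
    have t3 : (α + 1) ^ 4 ≤ (α + 1) ^ 4 * (N ^ 2 * y ^ 2) :=
      le_mul_of_one_le_right (by positivity) hNy
    have t4 : β ^ 4 * x ^ 4 ≤ β ^ 4 * (N ^ 2 * y ^ 2) := by gcongr; linarith
    linarith
  set C := 8 * (38 + 24 * E) + (α + 1) ^ 4 + β ^ 4
  have hC : 0 ≤ C := by positivity
  calc _ ≤ 16 * y * Om * (1 + 27 / N ^ 2 * (C * (N ^ 2 * y ^ 2))) := by gcongr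
    _ = 16 * y * Om * (1 + 27 * C * y ^ 2) := by field_simp
    _ ≤ 16 * y * Om * (y ^ 2 + 27 * C * y ^ 2) := by gcongr
    _ = _ := by ring

theorem Top_weighted_estimate (a : ℝ) (ha : 0 ≤ a) (α β : ℝ) (hα : 0 ≤ α) (hαβ : α ≤ β) :
    ∃ M : ℝ, 0 < M ∧ ∀ n : ℕ, 1 ≤ n → ∀ f : ℝ → ℝ, ContinuousOn f (Set.Ici 0) →
      (∃ Mf : ℝ, ∀ x : ℝ, 0 ≤ x → |f x| ≤ Mf * (1 + x ^ 2)) →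
      (∃ l : ℝ, Tendsto (fun x : ℝ => f x / (1 + x ^ 2)) atTop (nhds l)) →
      (⨆ x : {x : ℝ // 0 ≤ x},
          |TKS n a α β f x.val - f x.val| / (1 + x.val ^ 2) ^ 3) ≤
        M * OmegaW f (((n : ℝ) + β) ^ (-(1 : ℝ) / 2)) := by
  refine ⟨16 * (1 + 27 * (8 * (38 + 24 * Real.exp (Real.exp 1 * a)) + (α + 1) ^ 4 + β ^ 4)),
    by positivity, ?_⟩
  intro n hn f hf hMf _
  obtain ⟨Mf, hMf⟩ := hMf
  obtain ⟨m, rfl⟩ : ∃ m, n = m + 1 := ⟨n - 1, by omega⟩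
  have hN1 : 1 ≤ ((m + 1 : ℕ) : ℝ) + β := by
    push_cast
    linarith [(Nat.cast_nonneg m : (0 : ℝ) ≤ m)]
  obtain ⟨d1, d2, d3⟩ := delta_prop _ hN1
  obtain ⟨o1, o2⟩ := omega_prop f ((((m + 1 : ℕ) : ℝ) + β) ^ (-(1 : ℝ) / 2)) Mf hMf
  have : Nonempty {x : ℝ // 0 ≤ x} := ⟨⟨0, le_rfl⟩⟩
  refine ciSup_le fun x => ?_
  have hx := x.2
  rw [div_le_iff₀ (by positivity)]
  exact main_pointwise a ha α β hα hαβ m f hf _ _ o1 d1 d2 d3 o2 x.1 hx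
end
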